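/- BMO from dyadic BMO (one-parameter): There is a constant C = C(N) with the following property. Let ω ↦ f_ω be a family of locally integrable functions on ℝ^N, jointly measurable in (ω,x), such that ‖f_ω‖_{BMO_{D(ω)}} ≤ 1 for almost every ω, and suppose the function f(x) := E_ω f_ω(x) is defined (the expectation exists) for almost every x. Then f ∈ BMO(ℝ^N) and ‖f‖_{BMO} ≤ C. -/

import Mathlib

open MeasureTheory Filter Topology
open scoped ENNReal

noncomputable section

namespace Treil

/-- The cube of sidelength `2^k` of the dyadic lattice `t + 𝒟₀` that contains `x`. -/
def dcube {N : ℕ} (t : Fin N → ℝ) (k : ℤ) (x : Fin N → ℝ) : Set (Fin N → ℝ) :=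
  {y | ∀ i, ⌊(y i - t i) / (2 : ℝ) ^ k⌋ = ⌊(x i - t i) / (2 : ℝ) ^ k⌋}

/-- The averaging operator `E_k` over the cubes of sidelength `2^k` of the (generalized)
dyadic lattice whose layer at scale `2^k` has offset `c k`. -/
def avg {N : ℕ} (c : ℤ → Fin N → ℝ) (k : ℤ) (f : (Fin N → ℝ) → ℝ) (x : Fin N → ℝ) : ℝ :=
  (∫ y in dcube (c k) k x, f y) / ((2 : ℝ) ^ k) ^ (N : ℕ)

/-- The martingale difference `Δ_k = E_{k-1} - E_k`. -/
def mdiff {N : ℕ} (c : ℤ → Fin N → ℝ) (k : ℤ) (f : (Fin N → ℝ) → ℝ) (x : Fin N → ℝ) : ℝ :=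
  avg c (k - 1) f x - avg c k f x

/-- The square of the dyadic square function, `|S_𝒟 f (x)|² = ∑_k |Δ_k f (x)|²`,
with values in `[0,∞]`. -/
def Ssq {N : ℕ} (c : ℤ → Fin N → ℝ) (f : (Fin N → ℝ) → ℝ) (x : Fin N → ℝ) : ℝ≥0∞ :=
  ∑' k : ℤ, ENNReal.ofReal ((mdiff c k f x) ^ 2)

/-- The offset (at scale `2^k`) of the random dyadic lattice on `ℝ` built from the uniform
shift `u ∈ [0,1)` and the fair signs `ξ_j`, `j ≥ 1`, encoded as the binary digits of
`v ∈ [0,1)` (`ξ_j = -1` iff `⌊v 2^j⌋` is odd); the interval `I_0 = [u-1, u)` belongs to the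
lattice, and `I_k` is obtained from `I_{k-1}` by adjoining the right neighbour if `ξ_k = +1`
and the left neighbour if `ξ_k = -1`. -/
def randOffset1 (u v : ℝ) (k : ℤ) : ℝ :=
  u - 1 - ∑ j ∈ Finset.range k.toNat, (if ⌊v * 2 ^ (j + 1)⌋ % 2 = 1 then (2 : ℝ) ^ j else 0)

/-- The sample space for the random dyadic lattice in `ℝ^N`: each of the `N` independent
coordinate lattices is driven by a pair (uniform shift, digit-encoded fair signs). -/
abbrev RSpace (N : ℕ) := Fin N → ℝ × ℝ

/-- The probability measure of the random dyadic lattice in `ℝ^N`. -/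
def randMeasure (N : ℕ) : Measure (RSpace N) :=
  Measure.pi fun _ =>
    (volume.restrict (Set.Ico (0 : ℝ) 1)).prod (volume.restrict (Set.Ico (0 : ℝ) 1))

/-- The per-scale offsets of the random dyadic lattice `𝒟(ω)` in `ℝ^N`. -/
def randOffset {N : ℕ} (ω : RSpace N) (k : ℤ) : Fin N → ℝ :=
  fun i => randOffset1 (ω i).1 (ω i).2 k

/-- An (axis-parallel, half-open) cube in `ℝ^N`. -/
def IsPCube {N : ℕ} (Q : Set (Fin N → ℝ)) : Prop :=
  ∃ (a : Fin N → ℝ) (l : ℝ), 0 < l ∧ Q = Set.univ.pi fun i => Set.Ico (a i) (a i + l)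

/-- An `H¹`-atom: supported in a cube `Q`, bounded by `|Q|⁻¹`, with zero mean. -/
def IsAtom {N : ℕ} (a : (Fin N → ℝ) → ℝ) : Prop :=
  ∃ Q : Set (Fin N → ℝ), IsPCube Q ∧ (∀ x, x ∉ Q → a x = 0) ∧
    (∀ x, |a x| ≤ ((volume Q).toReal)⁻¹) ∧ (∫ x, a x) = 0

/-- The atomic `H¹(ℝ^N)` norm: the infimum of `∑ |λ_j|` over all decompositions
`f = ∑ λ_j a_j` converging in `L¹`, with atoms `a_j`. -/
def H1norm {N : ℕ} (f : (Fin N → ℝ) → ℝ) : ℝ≥0∞ :=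
  ⨅ (lam : ℕ → ℝ) (a : ℕ → (Fin N → ℝ) → ℝ) (_ : ∀ j, IsAtom (a j))
    (_ : Tendsto (fun m => ∫ x, |f x - ∑ j ∈ Finset.range m, lam j * a j x|) atTop (𝓝 0)),
    ∑' j, ENNReal.ofReal |lam j|
/-- The mean oscillation of `f` over a set `Q`: `|Q|⁻¹ ∫_Q |f - f_Q|`. -/
def cubeOsc {N : ℕ} (f : (Fin N → ℝ) → ℝ) (Q : Set (Fin N → ℝ)) : ℝ :=
  (∫ y in Q, |f y - (∫ z in Q, f z) / (volume Q).toReal|) / (volume Q).toReal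

/-- The bit reversal of the first `n` binary digits of `v`. -/
def revDigits (n : ℕ) (v : ℝ) : ℕ :=
  ∑ j ∈ Finset.range n, (if ⌊v * 2 ^ (j + 1)⌋ % 2 = 1 then 2 ^ j else 0)

lemma randOffset1_eq (u v : ℝ) (k : ℤ) :
    randOffset1 u v k = u - 1 - (revDigits k.toNat v : ℝ) := by
  simp only [randOffset1, revDigits]
  push_cast
  rfl

lemma measurable_revDigits (n : ℕ) : Measurable (revDigits n) := by
  unfold revDigits
  refine Finset.measurable_sum _ fun j _ => ?_
  refine Measurable.ite ?_ measurable_const measurable_const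
  have h : Measurable fun v : ℝ => ⌊v * 2 ^ (j + 1)⌋ := (measurable_id.mul_const _).floor
  exact h (MeasurableSet.of_discrete (s := {z : ℤ | z % 2 = 1}))

lemma measurable_randOffset1 (k : ℤ) : Measurable fun p : ℝ × ℝ => randOffset1 p.1 p.2 k := by
  simp only [randOffset1_eq]
  exact (measurable_fst.sub_const 1).sub
    ((measurable_from_nat (f := fun n : ℕ => (n : ℝ))).comp
      ((measurable_revDigits _).comp measurable_snd))

lemma revDigits_succ_half (n : ℕ) {v : ℝ} (hv : v ∈ Set.Ico (0 : ℝ) 1) :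
    revDigits (n + 1) (v / 2) = 2 * revDigits n v := by
  have h0 : ⌊v / 2 * 2 ^ (0 + 1)⌋ = 0 := by
    rw [Int.floor_eq_zero_iff]
    convert hv using 1
    ring
  rw [revDigits, Finset.sum_range_succ', h0, revDigits, Finset.mul_sum]
  simp only [Int.zero_emod, zero_ne_one, if_false, add_zero]
  refine Finset.sum_congr rfl fun j _ => ?_
  rw [show v / 2 * 2 ^ (j + 1 + 1) = v * 2 ^ (j + 1) by ring]
  split_ifs <;> ring

lemma revDigits_succ_half_add (n : ℕ) {v : ℝ} (hv : v ∈ Set.Ico (0 : ℝ) 1) :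
    revDigits (n + 1) ((v + 1) / 2) = 2 * revDigits n v + 1 := by
  have h0 : ⌊(v + 1) / 2 * 2 ^ (0 + 1)⌋ = 1 := by
    rw [Int.floor_eq_iff]
    constructor <;> norm_num <;> linarith [hv.1, hv.2]
  rw [revDigits, Finset.sum_range_succ', h0, revDigits, Finset.mul_sum]
  norm_num
  refine Finset.sum_congr rfl fun j _ => ?_
  have h1 : ⌊(v + 1) / 2 * 2 ^ (j + 1 + 1)⌋ = ⌊v * 2 ^ (j + 1)⌋ + 2 * 2 ^ j := by
    rw [show (v + 1) / 2 * 2 ^ (j + 1 + 1) = v * 2 ^ (j + 1) + ((2 * 2 ^ j : ℤ) : ℝ) by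
      push_cast; ring, Int.floor_add_intCast]
  rw [h1, Int.add_mul_emod_self_left]
  split_ifs <;> ring

lemma lintegral_Ico_unit_split (h : ℝ → ℝ≥0∞) :
    ∫⁻ v in Set.Ico (0 : ℝ) 1, h v =
      2⁻¹ * ((∫⁻ v in Set.Ico (0 : ℝ) 1, h (v / 2)) +
        ∫⁻ v in Set.Ico (0 : ℝ) 1, h ((v + 1) / 2)) := by
  have key : ∀ b : ℝ, ∫⁻ v in Set.Ico (0 : ℝ) 1, h ((v + b) / 2) =
      2 * ∫⁻ v in Set.Ico (b / 2) ((1 + b) / 2), h v := by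
    intro b
    have him : Set.Ico (b / 2) ((1 + b) / 2) =
        (fun v : ℝ => (v + b) / 2) '' Set.Ico (0 : ℝ) 1 := by
      ext x
      constructor
      · intro hx
        exact ⟨2 * x - b, ⟨by linarith [hx.1], by linarith [hx.2]⟩, by simp⟩
      · rintro ⟨v, hv, rfl⟩
        exact ⟨by linarith [hv.1], by linarith [hv.2]⟩
    have hd : ∀ x ∈ Set.Ico (0 : ℝ) 1,
        HasDerivWithinAt (fun v : ℝ => (v + b) / 2) (1 / 2) (Set.Ico (0 : ℝ) 1) x :=
      fun x _ => (((hasDerivAt_id x).add_const b).div_const 2).hasDerivWithinAt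
    rw [him, lintegral_image_eq_lintegral_abs_deriv_mul measurableSet_Ico hd
      (fun x _ y _ hxy => by simpa using hxy),
      lintegral_const_mul' _ _ ENNReal.ofReal_ne_top, ← mul_assoc]
    have : (2 : ℝ≥0∞) * ENNReal.ofReal |1 / 2| = 1 := by
      rw [abs_of_pos (by norm_num), ← ENNReal.ofReal_ofNat, ← ENNReal.ofReal_mul (by norm_num)]
      norm_num
    rw [this, one_mul]
  have k0 := key 0
  have k1 := key 1
  norm_num at k0 k1
  rw [k0, k1, ← mul_add, ← mul_assoc, ENNReal.inv_mul_cancel (by norm_num) (by norm_num), one_mul,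
    ← lintegral_union measurableSet_Ico, Set.Ico_union_Ico_eq_Ico (by norm_num) (by norm_num)]
  rw [Set.disjoint_left]
  intro x hx hx'
  linarith [hx.2, hx'.1]

/-- The reversed digits of a uniform variable are uniformly distributed. -/
lemma lintegral_revDigits (n : ℕ) (h : ℕ → ℝ≥0∞) :
    ∫⁻ v in Set.Ico (0 : ℝ) 1, h (revDigits n v) =
      (2⁻¹) ^ n * ∑ q ∈ Finset.range (2 ^ n), h q := by
  induction n generalizing h with
  | zero => simp [revDigits]
  | succ n ih =>
    have e0 := setLIntegral_congr_fun (μ := volume) measurableSet_Ico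
      (fun v hv => by beta_reduce; rw [revDigits_succ_half n hv] :
        Set.EqOn (fun v => h (revDigits (n + 1) (v / 2)))
          (fun v => (fun q => h (2 * q)) (revDigits n v)) (Set.Ico (0 : ℝ) 1))
    have e1 := setLIntegral_congr_fun (μ := volume) measurableSet_Ico
      (fun v hv => by beta_reduce; rw [revDigits_succ_half_add n hv] :
        Set.EqOn (fun v => h (revDigits (n + 1) ((v + 1) / 2)))
          (fun v => (fun q => h (2 * q + 1)) (revDigits n v)) (Set.Ico (0 : ℝ) 1))
    rw [lintegral_Ico_unit_split,
      e0, e1,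
      ih fun q => h (2 * q), ih fun q => h (2 * q + 1), ← mul_add, ← mul_assoc, ← Finset.sum_add_distrib, pow_succ', pow_succ']
    congr 1
    generalize 2 ^ n = M
    induction M with
    | zero => simp
    | succ M ihM => rw [Finset.sum_range_succ, ihM, mul_add, mul_one, Finset.sum_range_succ,
        Finset.sum_range_succ, add_assoc]

lemma sum_lintegral_Ico_translate (G : ℝ → ℝ≥0∞) (M : ℕ) :
    ∑ q ∈ Finset.range M, ∫⁻ u in Set.Ico (0 : ℝ) 1, G (u - 1 - q) =
      ∫⁻ c in Set.Ico (-M : ℝ) 0, G c := by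
  induction M with
  | zero => simp
  | succ M ih =>
    have hmp : MeasurePreserving (fun u : ℝ => u - (1 + M)) volume volume :=
      measurePreserving_sub_right volume _
    have hpre : (fun u : ℝ => u - (1 + M)) ⁻¹' Set.Ico (-(M + 1 : ℕ) : ℝ) (-M : ℝ) =
        Set.Ico 0 1 := by
      ext u
      simp only [Set.mem_preimage, Set.mem_Ico]
      push_cast
      constructor <;> rintro ⟨h1, h2⟩ <;> constructor <;> linarith
    have h1 : ∫⁻ u in Set.Ico (0 : ℝ) 1, G (u - 1 - M) =
        ∫⁻ c in Set.Ico (-(M + 1 : ℕ) : ℝ) (-M : ℝ), G c := by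
      rw [← hmp.setLIntegral_comp_preimage_emb
        (MeasurableEquiv.subRight (1 + (M : ℝ))).measurableEmbedding G, hpre]
      simp only [sub_sub]
    rw [Finset.sum_range_succ, ih, h1, add_comm, ← lintegral_union measurableSet_Ico,
      Set.Ico_union_Ico_eq_Ico (by push_cast; linarith) (by simp)]
    rw [Set.disjoint_left]
    intro x hx hx'
    linarith [hx.2, hx'.1]

/-- The law of the offset of the layer at scale `2 ^ k`. -/
lemma lintegral_randOffset1 (k : ℤ) {G : ℝ → ℝ≥0∞} (hG : Measurable G) :
    ∫⁻ p : ℝ × ℝ, G (randOffset1 p.1 p.2 k)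
        ∂((volume.restrict (Set.Ico (0 : ℝ) 1)).prod (volume.restrict (Set.Ico (0 : ℝ) 1))) =
      (2⁻¹) ^ k.toNat * ∫⁻ c in Set.Ico (-(2 ^ k.toNat : ℕ) : ℝ) 0, G c := by
  simp only [randOffset1_eq]
  rw [lintegral_prod_symm, ← sum_lintegral_Ico_translate]
  · exact lintegral_revDigits k.toNat (fun q => ∫⁻ u in Set.Ico (0 : ℝ) 1, G (u - 1 - q))
  · simp only [← randOffset1_eq]
    exact (hG.comp (measurable_randOffset1 k)).aemeasurable

/-- The number of hyperplanes of the lattice of scale `2 ^ k` and offset `c` in `(y, y + l]`. -/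
def cuts (l : ℝ) (k : ℤ) (y c : ℝ) : ℕ :=
  (⌊(y + l - c) / (2 : ℝ) ^ k⌋ - ⌊(y - c) / (2 : ℝ) ^ k⌋).toNat

lemma measurable_cuts (l : ℝ) (k : ℤ) (y : ℝ) : Measurable (cuts l k y) := by
  have h : ∀ z : ℝ, Measurable fun c : ℝ => ⌊(z - c) / (2 : ℝ) ^ k⌋ := fun z =>
    ((measurable_const.sub measurable_id).div_const _).floor
  exact (measurable_from_top (f := Int.toNat)).comp ((h (y + l)).sub (h y))

lemma integral_fract_shift (k : ℤ) (z : ℝ) :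
    ∫ c in (-(2 ^ k.toNat : ℕ) : ℝ)..0, Int.fract ((z - c) / (2 : ℝ) ^ k) =
      ∫ c in (-(2 ^ k.toNat : ℕ) : ℝ)..0, Int.fract ((0 - c) / (2 : ℝ) ^ k) := by
  set T : ℝ := ((2 ^ k.toNat : ℕ) : ℝ) with hT
  have hper : Function.Periodic (fun c : ℝ => Int.fract ((0 - c) / (2 : ℝ) ^ k)) T := by
    intro c
    obtain ⟨n, hn⟩ : ∃ n : ℤ, T = n * (2 : ℝ) ^ k := by
      rcases le_total 0 k with hk | hk
      · refine ⟨1, ?_⟩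
        lift k to ℕ using hk
        simp [hT]
      · refine ⟨2 ^ (-k).toNat, ?_⟩
        have h1 : k.toNat = 0 := Int.toNat_of_nonpos hk
        have h2 : ((-k).toNat : ℤ) = -k := Int.toNat_of_nonneg (by omega)
        rw [hT, h1]
        push_cast
        rw [← zpow_natCast, h2, ← zpow_add₀ (by norm_num)]
        simp
    have h2 : (2 : ℝ) ^ k ≠ 0 := by positivity
    have : (0 - (c + T)) / (2 : ℝ) ^ k = (0 - c) / (2 : ℝ) ^ k - n := by
      rw [hn]; field_simp; ring
    simp only [this, Int.fract_sub_intCast]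
  have := hper.intervalIntegral_add_eq (-T - z) (-T)
  rw [neg_add_cancel] at this
  rw [← this, show -T - z + T = 0 - z by ring, ← intervalIntegral.integral_comp_sub_right
    (fun c => Int.fract ((0 - c) / (2 : ℝ) ^ k)) z]
  simp only [sub_sub_eq_add_sub, zero_add]

lemma cuts_cast_eq {l : ℝ} (hl : 0 ≤ l) (k : ℤ) (y c : ℝ) :
    (cuts l k y c : ℝ) = l / (2 : ℝ) ^ k - Int.fract ((y + l - c) / (2 : ℝ) ^ k) +
      Int.fract ((y - c) / (2 : ℝ) ^ k) := by
  have hle : ⌊(y - c) / (2 : ℝ) ^ k⌋ ≤ ⌊(y + l - c) / (2 : ℝ) ^ k⌋ := by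
    apply Int.floor_mono
    gcongr
    linarith
  have h1 : ((cuts l k y c : ℤ) : ℝ) =
      (⌊(y + l - c) / (2 : ℝ) ^ k⌋ : ℝ) - ⌊(y - c) / (2 : ℝ) ^ k⌋ := by
    rw [cuts, Int.toNat_of_nonneg (by omega)]
    push_cast
    rfl
  rw [Int.cast_natCast] at h1
  rw [h1, Int.fract, Int.fract]
  ring

lemma intervalIntegrable_fract (k : ℤ) (z a b : ℝ) :
    IntervalIntegrable (fun c => Int.fract ((z - c) / (2 : ℝ) ^ k)) volume a b := by
  refine (intervalIntegrable_const (c := (1 : ℝ))).mono_fun ?_ ?_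
  · exact (measurable_fract.comp
      ((measurable_const.sub measurable_id).div_const _)).aestronglyMeasurable
  · filter_upwards with c
    rw [Real.norm_of_nonneg (Int.fract_nonneg _), norm_one]
    exact (Int.fract_lt_one _).le

lemma lintegral_cuts {l : ℝ} (hl : 0 ≤ l) (k : ℤ) (y : ℝ) :
    ∫⁻ c in Set.Ico (-(2 ^ k.toNat : ℕ) : ℝ) 0, (cuts l k y c : ℝ≥0∞) =
      (2 ^ k.toNat) * ENNReal.ofReal (l / (2 : ℝ) ^ k) := by
  have hT : (-(2 ^ k.toNat : ℕ) : ℝ) ≤ 0 := by simp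
  have hi := ((intervalIntegrable_const (c := l / (2 : ℝ) ^ k)).sub
    (intervalIntegrable_fract k (y + l) (-(2 ^ k.toNat : ℕ) : ℝ) 0)).add
      (intervalIntegrable_fract k y (-(2 ^ k.toNat : ℕ) : ℝ) 0)
  have h1 : ∀ c, (cuts l k y c : ℝ≥0∞) = ENNReal.ofReal (cuts l k y c : ℝ) := by simp
  simp only [h1]
  rw [← ofReal_integral_eq_lintegral_ofReal, integral_Ico_eq_integral_Ioc,
    ← intervalIntegral.integral_of_le hT]
  · simp only [cuts_cast_eq hl]
    rw [intervalIntegral.integral_add (intervalIntegrable_const.sub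
      (intervalIntegrable_fract k (y + l) _ _)) (intervalIntegrable_fract k y _ _),
      intervalIntegral.integral_sub intervalIntegrable_const
      (intervalIntegrable_fract k (y + l) _ _), integral_fract_shift k (y + l),
      integral_fract_shift k y, sub_add_cancel, intervalIntegral.integral_const, smul_eq_mul,
      ENNReal.ofReal_mul (by simp)]
    congr 1
    simp
  · rw [Measure.restrict_congr_set Ico_ae_eq_Ioc]
    have := (intervalIntegrable_iff_integrableOn_Ioc_of_le hT).1 hi
    rw [IntegrableOn] at this
    refine this.congr (Eventually.of_forall fun c => ?_)
    exact (cuts_cast_eq hl k y c).symm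
  · filter_upwards with c
    simp

instance (N : ℕ) : IsProbabilityMeasure (randMeasure N) := by
  have : IsProbabilityMeasure ((volume : Measure ℝ).restrict (Set.Ico (0 : ℝ) 1)) :=
    ⟨by simp⟩
  unfold randMeasure
  infer_instance

lemma lintegral_cuts_randOffset {N : ℕ} {l : ℝ} (hl : 0 ≤ l) (k : ℤ) (y : ℝ) (i : Fin N) :
    ∫⁻ ω, (cuts l k y (randOffset ω k i) : ℝ≥0∞) ∂randMeasure N =
      ENNReal.ofReal (l / (2 : ℝ) ^ k) := by
  have : IsProbabilityMeasure ((volume : Measure ℝ).restrict (Set.Ico (0 : ℝ) 1)) :=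
    ⟨by simp⟩
  have hG : Measurable fun c => (cuts l k y c : ℝ≥0∞) :=
    (measurable_from_nat (f := fun n : ℕ => (n : ℝ≥0∞))).comp (measurable_cuts l k y)
  have h1 := (measurePreserving_eval (fun _ : Fin N =>
    ((volume : Measure ℝ).restrict (Set.Ico (0 : ℝ) 1)).prod
      (volume.restrict (Set.Ico (0 : ℝ) 1))) i).lintegral_comp (hG.comp (measurable_randOffset1 k))
  refine h1.trans ((lintegral_randOffset1 k hG).trans ?_)
  rw [lintegral_cuts hl, ← mul_assoc, ← mul_pow, ENNReal.inv_mul_cancel (by simp) (by simp),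
    one_pow, one_mul]

lemma dcube_eq_pi {N : ℕ} (t : Fin N → ℝ) (k : ℤ) (x : Fin N → ℝ) :
    dcube t k x = Set.univ.pi fun i =>
      Set.Ico (t i + ⌊(x i - t i) / (2 : ℝ) ^ k⌋ * (2 : ℝ) ^ k)
        (t i + (⌊(x i - t i) / (2 : ℝ) ^ k⌋ + 1) * (2 : ℝ) ^ k) := by
  ext y
  have h2 : (0 : ℝ) < (2 : ℝ) ^ k := by positivity
  simp only [dcube, Set.mem_ofPred_eq, Set.mem_univ_pi, Set.mem_Ico]
  refine forall_congr' fun i => ?_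
  rw [Int.floor_eq_iff, le_div_iff₀ h2, div_lt_iff₀ h2]
  constructor <;> rintro ⟨h3, h4⟩ <;> constructor <;> linarith

lemma volume_dcube {N : ℕ} (t : Fin N → ℝ) (k : ℤ) (x : Fin N → ℝ) :
    volume (dcube t k x) = ENNReal.ofReal (((2 : ℝ) ^ k) ^ N) := by
  rw [dcube_eq_pi, Real.volume_pi_Ico]
  have : ∀ i, t i + (⌊(x i - t i) / (2 : ℝ) ^ k⌋ + 1) * (2 : ℝ) ^ k -
      (t i + ⌊(x i - t i) / (2 : ℝ) ^ k⌋ * (2 : ℝ) ^ k) = (2 : ℝ) ^ k := fun i => by ring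
  simp only [this, Finset.prod_const, Finset.card_univ, Fintype.card_fin]
  rw [ENNReal.ofReal_pow (by positivity)]

lemma toReal_volume_dcube {N : ℕ} (t : Fin N → ℝ) (k : ℤ) (x : Fin N → ℝ) :
    (volume (dcube t k x)).toReal = ((2 : ℝ) ^ k) ^ N := by
  rw [volume_dcube, ENNReal.toReal_ofReal (by positivity)]

lemma dcube_eq_of_mem {N : ℕ} {t : Fin N → ℝ} {k : ℤ} {x y : Fin N → ℝ} (h : y ∈ dcube t k x) :
    dcube t k y = dcube t k x := by
  ext z
  exact forall_congr' fun i => by rw [h i]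

/-- Consecutive layers of the random lattice are nested. -/
lemma dcube_randOffset_subset_succ {N : ℕ} (ω : RSpace N) (k : ℤ) (x : Fin N → ℝ) :
    dcube (randOffset ω k) k x ⊆ dcube (randOffset ω (k + 1)) (k + 1) x := by
  intro y hy i
  obtain ⟨b, hb⟩ : ∃ b : ℤ, randOffset ω k i - randOffset ω (k + 1) i = b * (2 : ℝ) ^ k := by
    rcases le_or_gt 0 k with hk | hk
    · lift k to ℕ using hk
      refine ⟨if ⌊(ω i).2 * 2 ^ (k + 1)⌋ % 2 = 1 then 1 else 0, ?_⟩
      simp only [randOffset, randOffset1]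
      rw [show ((k : ℤ) + 1).toNat = k + 1 by omega, Int.toNat_natCast, Finset.sum_range_succ]
      split_ifs <;> simp
    · refine ⟨0, ?_⟩
      simp only [randOffset, randOffset1]
      rw [show k.toNat = 0 by omega, show (k + 1).toNat = 0 by omega]
      simp
  have key : ∀ z : Fin N → ℝ, ⌊(z i - randOffset ω (k + 1) i) / (2 : ℝ) ^ (k + 1)⌋ =
      (⌊(z i - randOffset ω k i) / (2 : ℝ) ^ k⌋ + b) / 2 := by
    intro z
    have h2 : (2 : ℝ) ^ k ≠ 0 := by positivity
    have : (z i - randOffset ω (k + 1) i) / (2 : ℝ) ^ (k + 1) =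
        ((z i - randOffset ω k i) / (2 : ℝ) ^ k + b) / (2 : ℕ) := by
      rw [zpow_add_one₀ (by norm_num),
        show z i - randOffset ω (k + 1) i = z i - randOffset ω k i + b * (2 : ℝ) ^ k by
          rw [← hb]; ring]
      push_cast
      field_simp
    rw [this, Int.floor_div_natCast, Int.floor_add_intCast]
    rfl
  rw [key, key, hy i]

section Deterministic

variable {N : ℕ} {f : (Fin N → ℝ) → ℝ}

lemma integrableOn_abs_sub_const {S : Set (Fin N → ℝ)} (hS : volume S ≠ ⊤)
    (hi : IntegrableOn f S) (a : ℝ) : IntegrableOn (fun y => |f y - a|) S :=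
  (hi.sub (integrableOn_const hS)).abs

lemma integral_dcube_abs_sub_avg_le {c : ℤ → Fin N → ℝ} {k : ℤ} {x : Fin N → ℝ}
    (ho : cubeOsc f (dcube (c k) k x) ≤ 1) :
    ∫ y in dcube (c k) k x, |f y - avg c k f x| ≤ ((2 : ℝ) ^ k) ^ N := by
  have h2 : (0 : ℝ) < ((2 : ℝ) ^ k) ^ N := by positivity
  rw [cubeOsc, toReal_volume_dcube, div_le_one h2] at ho
  exact ho

lemma abs_avg_sub_avg_succ_le {ω : RSpace N} {k : ℤ} {x : Fin N → ℝ}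
    (hi : IntegrableOn f (dcube (randOffset ω (k + 1)) (k + 1) x))
    (ho : cubeOsc f (dcube (randOffset ω (k + 1)) (k + 1) x) ≤ 1) :
    |avg (randOffset ω) k f x - avg (randOffset ω) (k + 1) f x| ≤ 2 ^ N := by
  have h2 : (0 : ℝ) < ((2 : ℝ) ^ k) ^ N := by positivity
  have hsub := dcube_randOffset_subset_succ ω k x
  have hfin : ∀ j, volume (dcube (randOffset ω j) j x) ≠ ⊤ := fun j => by
    rw [volume_dcube]; exact ENNReal.ofReal_ne_top
  set a := avg (randOffset ω) (k + 1) f x with ha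
  have h1 : avg (randOffset ω) k f x - a =
      (∫ y in dcube (randOffset ω k) k x, (f y - a)) / ((2 : ℝ) ^ k) ^ N := by
    rw [integral_sub (hi.mono_set hsub) (integrableOn_const (hfin k)), setIntegral_const, avg,
      measureReal_def, toReal_volume_dcube, smul_eq_mul]
    field_simp
  rw [h1, abs_div, abs_of_pos h2, div_le_iff₀ h2]
  calc |∫ y in dcube (randOffset ω k) k x, (f y - a)|
      ≤ ∫ y in dcube (randOffset ω k) k x, |f y - a| := abs_integral_le_integral_abs
    _ ≤ ∫ y in dcube (randOffset ω (k + 1)) (k + 1) x, |f y - a| :=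
        setIntegral_mono_set (integrableOn_abs_sub_const (hfin _) hi a)
          (Eventually.of_forall fun _ => abs_nonneg _) hsub.eventuallyLE
    _ ≤ ((2 : ℝ) ^ (k + 1)) ^ N := integral_dcube_abs_sub_avg_le ho
    _ = 2 ^ N * ((2 : ℝ) ^ k) ^ N := by rw [zpow_add_one₀ (by norm_num), mul_pow, mul_comm]

lemma abs_avg_sub_avg_add_le {ω : RSpace N}
    (h : ∀ (k : ℤ) (x : Fin N → ℝ), IntegrableOn f (dcube (randOffset ω k) k x) volume ∧
      cubeOsc f (dcube (randOffset ω k) k x) ≤ 1) (k : ℤ) (x : Fin N → ℝ) (m : ℕ) :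
    |avg (randOffset ω) k f x - avg (randOffset ω) (k + m) f x| ≤ 2 ^ N * m := by
  induction m with
  | zero => simp
  | succ m ih =>
    have h1 := abs_avg_sub_avg_succ_le (h (k + m + 1) x).1 (h (k + m + 1) x).2
    have h2 := abs_sub_le (avg (randOffset ω) k f x) (avg (randOffset ω) (k + m) f x)
      (avg (randOffset ω) (k + m + 1) f x)
    push_cast
    rw [← add_assoc]
    linarith

lemma lintegral_dcube_enorm_sub_le {ω : RSpace N}
    (h : ∀ (k : ℤ) (x : Fin N → ℝ), IntegrableOn f (dcube (randOffset ω k) k x) volume ∧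
      cubeOsc f (dcube (randOffset ω k) k x) ≤ 1) (k : ℤ) (x : Fin N → ℝ) (m : ℕ) :
    ∫⁻ y in dcube (randOffset ω k) k x, ‖f y - avg (randOffset ω) (k + m) f x‖ₑ ≤
      ENNReal.ofReal (((2 : ℝ) ^ k) ^ N) * (1 + 2 ^ N * m) := by
  have hfin : volume (dcube (randOffset ω k) k x) ≠ ⊤ := by
    rw [volume_dcube]; exact ENNReal.ofReal_ne_top
  have hint := integrableOn_abs_sub_const hfin (h k x).1 (avg (randOffset ω) k f x)
  calc ∫⁻ y in dcube (randOffset ω k) k x, ‖f y - avg (randOffset ω) (k + m) f x‖ₑ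
      ≤ ∫⁻ y in dcube (randOffset ω k) k x,
          (ENNReal.ofReal |f y - avg (randOffset ω) k f x| + ENNReal.ofReal (2 ^ N * m)) := by
        refine lintegral_mono fun y => ?_
        rw [Real.enorm_eq_ofReal_abs, ← ENNReal.ofReal_add (abs_nonneg _) (by positivity)]
        refine ENNReal.ofReal_le_ofReal ((abs_sub_le _ (avg (randOffset ω) k f x) _).trans ?_)
        gcongr
        exact abs_avg_sub_avg_add_le h k x m
    _ = ENNReal.ofReal (∫ y in dcube (randOffset ω k) k x, |f y - avg (randOffset ω) k f x|) +
          ENNReal.ofReal (2 ^ N * m) * ENNReal.ofReal (((2 : ℝ) ^ k) ^ N) := by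
        rw [lintegral_add_right _ measurable_const, setLIntegral_const, volume_dcube,
          ofReal_integral_eq_lintegral_ofReal hint (Eventually.of_forall fun _ => abs_nonneg _)]
    _ ≤ ENNReal.ofReal (((2 : ℝ) ^ k) ^ N) +
          ENNReal.ofReal (2 ^ N * m) * ENNReal.ofReal (((2 : ℝ) ^ k) ^ N) := by
        gcongr
        exact integral_dcube_abs_sub_avg_le (h k x).2
    _ = _ := by
        rw [ENNReal.ofReal_mul (by positivity), ENNReal.ofReal_natCast,
          ENNReal.ofReal_pow (by norm_num : (0 : ℝ) ≤ 2), ENNReal.ofReal_ofNat]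
        ring

/-- The total number of cuts of the cube with corner `a` and sidelength `l` by the layers of the
random lattice of scale at least `2 ^ k`. -/
def totalCuts (a : Fin N → ℝ) (l : ℝ) (k : ℤ) (ω : RSpace N) : ℝ≥0∞ :=
  ∑' m : ℕ, ∑ i, (cuts l (k + m) (a i) (randOffset ω (k + m) i) : ℝ≥0∞)

/-- The vertices of the cube with corner `a` and sidelength `l`. -/
def vertex (a : Fin N → ℝ) (l : ℝ) (s : Fin N → Bool) : Fin N → ℝ :=
  fun i => if s i then a i + l else a i

lemma cube_subset_iUnion_dcube (t a : Fin N → ℝ) {l : ℝ} {k : ℤ} (hlk : l ≤ (2 : ℝ) ^ k) :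
    (Set.univ.pi fun i => Set.Ico (a i) (a i + l)) ⊆ ⋃ s, dcube t k (vertex a l s) := by
  intro x hx
  have h2 : (0 : ℝ) < (2 : ℝ) ^ k := by positivity
  rw [Set.mem_iUnion]
  refine ⟨fun i => decide (⌊(x i - t i) / (2 : ℝ) ^ k⌋ ≠ ⌊(a i - t i) / (2 : ℝ) ^ k⌋), fun i => ?_⟩
  have hxi := hx i (Set.mem_univ i)
  by_cases hc : ⌊(x i - t i) / (2 : ℝ) ^ k⌋ = ⌊(a i - t i) / (2 : ℝ) ^ k⌋
  · simp [vertex, hc]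
  · simp only [vertex, hc, ne_eq, not_false_eq_true, decide_true, if_true]
    have h3 : ⌊(a i - t i) / (2 : ℝ) ^ k⌋ ≤ ⌊(x i - t i) / (2 : ℝ) ^ k⌋ := by
      apply Int.floor_mono
      gcongr
      exact hxi.1
    have h4 : ⌊(x i - t i) / (2 : ℝ) ^ k⌋ ≤ ⌊(a i + l - t i) / (2 : ℝ) ^ k⌋ := by
      apply Int.floor_mono
      gcongr
      exact hxi.2.le
    have h5 : ⌊(a i + l - t i) / (2 : ℝ) ^ k⌋ ≤ ⌊(a i - t i) / (2 : ℝ) ^ k⌋ + 1 := by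
      rw [← Int.floor_add_one]
      apply Int.floor_mono
      rw [div_add_one h2.ne']
      gcongr
      linarith
    omega

lemma dcube_vertex_eq {t a : Fin N → ℝ} {l : ℝ} {k : ℤ} (hl : 0 ≤ l)
    (h : ∀ i, cuts l k (a i) (t i) = 0) (s : Fin N → Bool) :
    dcube t k (vertex a l s) = dcube t k a := by
  refine dcube_eq_of_mem fun i => ?_
  have h3 : ⌊(a i - t i) / (2 : ℝ) ^ k⌋ ≤ ⌊(a i + l - t i) / (2 : ℝ) ^ k⌋ := by
    apply Int.floor_mono
    gcongr
    linarith
  have h4 := h i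
  rw [cuts, Int.toNat_eq_zero] at h4
  unfold vertex
  split_ifs
  · omega
  · rfl

lemma exists_no_cuts {a : Fin N → ℝ} {l : ℝ} {k : ℤ} {ω : RSpace N}
    (hfin : totalCuts a l k ω ≠ ⊤) :
    ∃ m : ℕ, (∀ i, cuts l (k + m) (a i) (randOffset ω (k + m) i) = 0) ∧
      (m : ℝ≥0∞) ≤ totalCuts a l k ω := by
  classical
  set D : ℕ → ℕ := fun m => ∑ i, cuts l (k + m) (a i) (randOffset ω (k + m) i) with hD
  have hT : totalCuts a l k ω = ∑' m, (D m : ℝ≥0∞) := by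
    simp only [totalCuts, hD, Nat.cast_sum]
  have hle : ∀ m : ℕ, (∀ j < m, D j ≠ 0) → (m : ℝ≥0∞) ≤ totalCuts a l k ω := by
    intro m hm
    rw [hT]
    calc (m : ℝ≥0∞) = ∑ j ∈ Finset.range m, 1 := by simp
      _ ≤ ∑ j ∈ Finset.range m, (D j : ℝ≥0∞) := by
        refine Finset.sum_le_sum fun j hj => ?_
        have := hm j (Finset.mem_range.1 hj)
        exact_mod_cast Nat.one_le_iff_ne_zero.2 this
      _ ≤ _ := ENNReal.sum_le_tsum _
  have hex : ∃ m, D m = 0 := by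
    by_contra! hne
    obtain ⟨n, hn⟩ := ENNReal.exists_nat_gt hfin
    exact absurd (hle n fun j _ => hne j) (not_le.2 hn)
  refine ⟨Nat.find hex, fun i => ?_, hle _ fun j hj => Nat.find_min hex hj⟩
  exact Finset.sum_eq_zero_iff.1 (Nat.find_spec hex) i (Finset.mem_univ i)

lemma lintegral_cube_enorm_sub_le {ω : RSpace N}
    (h : ∀ (k : ℤ) (x : Fin N → ℝ), IntegrableOn f (dcube (randOffset ω k) k x) volume ∧
      cubeOsc f (dcube (randOffset ω k) k x) ≤ 1) (a : Fin N → ℝ) {l : ℝ} (hl : 0 ≤ l) {k : ℤ}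
    (hlk : l ≤ (2 : ℝ) ^ k) :
    ∃ b : ℝ, ∫⁻ y in Set.univ.pi fun i => Set.Ico (a i) (a i + l), ‖f y - b‖ₑ ≤
      2 ^ N * (ENNReal.ofReal (((2 : ℝ) ^ k) ^ N) * (1 + 2 ^ N * totalCuts a l k ω)) := by
  by_cases hfin : totalCuts a l k ω = ⊤
  · refine ⟨0, le_of_le_of_eq le_top ?_⟩
    have h1 : ENNReal.ofReal (((2 : ℝ) ^ k) ^ N) ≠ 0 := by
      rw [Ne, ENNReal.ofReal_eq_zero, not_le]
      positivity
    rw [hfin, ENNReal.mul_top (by simp), add_top, ENNReal.mul_top h1, ENNReal.mul_top (by simp)]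
  · obtain ⟨m, hm, hle⟩ := exists_no_cuts hfin
    refine ⟨avg (randOffset ω) (k + m) f a, ?_⟩
    have hav : ∀ s, avg (randOffset ω) (k + m) f (vertex a l s) =
        avg (randOffset ω) (k + m) f a := fun s => by
      rw [avg, avg, dcube_vertex_eq hl hm s]
    calc ∫⁻ y in Set.univ.pi fun i => Set.Ico (a i) (a i + l),
          ‖f y - avg (randOffset ω) (k + m) f a‖ₑ
        ≤ ∫⁻ y in ⋃ s, dcube (randOffset ω k) k (vertex a l s),
          ‖f y - avg (randOffset ω) (k + m) f a‖ₑ :=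
          lintegral_mono_set (cube_subset_iUnion_dcube _ a hlk)
      _ ≤ ∑ s, ∫⁻ y in dcube (randOffset ω k) k (vertex a l s),
          ‖f y - avg (randOffset ω) (k + m) f a‖ₑ := by
          refine (lintegral_iUnion_le _ _).trans ?_
          rw [tsum_fintype]
      _ ≤ ∑ s : Fin N → Bool, ENNReal.ofReal (((2 : ℝ) ^ k) ^ N) *
            (1 + 2 ^ N * totalCuts a l k ω) := by
          refine Finset.sum_le_sum fun s _ => ?_
          rw [← hav s]
          refine (lintegral_dcube_enorm_sub_le h k _ m).trans ?_
          gcongr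
      _ = _ := by simp

end Deterministic

lemma measurable_cuts_randOffset {N : ℕ} (l : ℝ) (k : ℤ) (y : ℝ) (i : Fin N) :
    Measurable fun ω : RSpace N => (cuts l k y (randOffset ω k i) : ℝ≥0∞) :=
  (measurable_from_nat (f := fun n : ℕ => (n : ℝ≥0∞))).comp
    ((measurable_cuts l k y).comp ((measurable_randOffset1 k).comp (measurable_pi_apply i)))

lemma lintegral_totalCuts_le {N : ℕ} (a : Fin N → ℝ) {l : ℝ} (hl : 0 ≤ l) {k : ℤ}
    (hlk : l ≤ (2 : ℝ) ^ k) : ∫⁻ ω, totalCuts a l k ω ∂randMeasure N ≤ 2 * N := by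
  unfold totalCuts
  rw [lintegral_tsum fun m : ℕ => (Finset.measurable_sum _ fun i _ =>
    measurable_cuts_randOffset l (k + m) (a i) i).aemeasurable]
  have h1 : ∀ m : ℕ, ∫⁻ ω, ∑ i, (cuts l (k + m) (a i) (randOffset ω (k + m) i) : ℝ≥0∞)
      ∂randMeasure N ≤ N * 2⁻¹ ^ m := by
    intro m
    rw [lintegral_finsetSum _ fun i _ => measurable_cuts_randOffset l (k + m) (a i) i]
    simp only [lintegral_cuts_randOffset hl, Finset.sum_const, Finset.card_univ,
      Fintype.card_fin, nsmul_eq_mul]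
    gcongr
    have h2 : (2⁻¹ : ℝ≥0∞) = ENNReal.ofReal 2⁻¹ := by
      rw [ENNReal.ofReal_inv_of_pos (by norm_num), ENNReal.ofReal_ofNat]
    rw [h2, ← ENNReal.ofReal_pow (by norm_num)]
    refine ENNReal.ofReal_le_ofReal ?_
    rw [zpow_add₀ (by norm_num), zpow_natCast, div_le_iff₀ (by positivity), inv_pow]
    field_simp
    exact hlk
  refine (ENNReal.tsum_le_tsum h1).trans ?_
  rw [ENNReal.tsum_mul_left, ENNReal.tsum_geometric, ENNReal.one_sub_inv_two, inv_inv, mul_comm]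

lemma lintegral_lintegral_enorm_sub_le {α : Type*} [MeasurableSpace α] (μ : Measure α)
    {f : α → ℝ} (hf : Measurable f) (b : ℝ) :
    ∫⁻ x, ∫⁻ y, ‖f x - f y‖ₑ ∂μ ∂μ ≤ 2 * μ Set.univ * ∫⁻ y, ‖f y - b‖ₑ ∂μ := by
  have hm : Measurable fun y => ‖f y - b‖ₑ := (hf.sub_const b).enorm
  calc ∫⁻ x, ∫⁻ y, ‖f x - f y‖ₑ ∂μ ∂μ
      ≤ ∫⁻ x, ∫⁻ y, (‖f x - b‖ₑ + ‖f y - b‖ₑ) ∂μ ∂μ := by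
        refine lintegral_mono fun x => lintegral_mono fun y => ?_
        rw [show f x - f y = (f x - b) - (f y - b) by ring]
        exact enorm_sub_le
    _ = _ := by
        simp only [lintegral_add_right _ hm, lintegral_const]
        rw [lintegral_add_right _ measurable_const, lintegral_mul_const _ hm, lintegral_const]
        ring

lemma cubeOsc_le_of_lintegral {N : ℕ} {f : (Fin N → ℝ) → ℝ} {Q : Set (Fin N → ℝ)} {C : ℝ}
    (hC : 0 ≤ C) (hQ : 0 < (volume Q).toReal) (hf : IntegrableOn f Q)
    (h : ∫⁻ x in Q, ∫⁻ y in Q, ‖f x - f y‖ₑ ≤ ENNReal.ofReal C * volume Q ^ 2) :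
    cubeOsc f Q ≤ C := by
  have hQtop : volume Q ≠ ⊤ := fun h0 => by simp [h0] at hQ
  have hQ0 : volume Q ≠ 0 := fun h0 => by simp [h0] at hQ
  set V := (volume Q).toReal with hV
  set b := (∫ z in Q, f z) / V with hb
  have hVe : volume Q = ENNReal.ofReal V := (ENNReal.ofReal_toReal hQtop).symm
  have hpt : ∀ x, ‖f x - b‖ₑ * volume Q ≤ ∫⁻ y in Q, ‖f x - f y‖ₑ := by
    intro x
    have h1 : ∫ y in Q, (f x - f y) = (f x - b) * V := by
      rw [integral_sub (integrableOn_const (C := f x) hQtop).integrable hf, setIntegral_const, measureReal_def,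
        smul_eq_mul, hb, ← hV]
      field_simp
    calc ‖f x - b‖ₑ * volume Q = ‖(f x - b) * V‖ₑ := by
          rw [enorm_mul, hVe, Real.enorm_of_nonneg hQ.le]
      _ ≤ _ := by rw [← h1]; exact enorm_integral_le_lintegral_enorm _
  have h2 : (∫⁻ x in Q, ‖f x - b‖ₑ) * volume Q ≤ (ENNReal.ofReal C * volume Q) * volume Q := by
    rw [← lintegral_mul_const' _ _ hQtop, mul_assoc, ← sq]
    exact (lintegral_mono hpt).trans h
  have h3 := (ENNReal.mul_le_mul_iff_left hQ0 hQtop).1 h2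
  have hint : IntegrableOn (fun y => |f y - b|) Q := integrableOn_abs_sub_const hQtop hf b
  rw [cubeOsc, div_le_iff₀ hQ, ← ENNReal.ofReal_le_ofReal_iff (by positivity),
    ofReal_integral_eq_lintegral_ofReal hint (Eventually.of_forall fun _ => abs_nonneg _),
    ENNReal.ofReal_mul hC, ← hVe]
  simpa only [Real.enorm_eq_ofReal_abs] using h3

lemma lintegral_oscillation_le {N : ℕ} {F : RSpace N → (Fin N → ℝ) → ℝ}
    (hF : Measurable (Function.uncurry F))
    (h : ∀ᵐ ω ∂randMeasure N, ∀ (k : ℤ) (x : Fin N → ℝ),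
      IntegrableOn (F ω) (dcube (randOffset ω k) k x) volume ∧
      cubeOsc (F ω) (dcube (randOffset ω k) k x) ≤ 1)
    (a : Fin N → ℝ) {l : ℝ} (hl : 0 < l) {Q : Set (Fin N → ℝ)}
    (hQ : Q = Set.univ.pi fun i => Set.Ico (a i) (a i + l)) :
    ∫⁻ ω, (∫⁻ x in Q, ∫⁻ y in Q, ‖F ω x - F ω y‖ₑ) ∂randMeasure N ≤
      ENNReal.ofReal (2 * 4 ^ N * (1 + 2 ^ N * (2 * N))) * volume Q ^ 2 := by
  obtain ⟨n, hn1, hn2⟩ := exists_mem_Ioc_zpow hl (one_lt_two : (1 : ℝ) < 2)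
  have hvol : volume Q = ENNReal.ofReal l ^ N := by
    rw [hQ, Real.volume_pi_Ico]
    simp
  have hk : ENNReal.ofReal (((2 : ℝ) ^ (n + 1)) ^ N) ≤ 2 ^ N * volume Q := by
    rw [hvol, ← mul_pow, ENNReal.ofReal_pow (by positivity)]
    gcongr
    rw [← ENNReal.ofReal_ofNat, ← ENNReal.ofReal_mul (by norm_num)]
    refine ENNReal.ofReal_le_ofReal ?_
    rw [zpow_add_one₀ (by norm_num)]
    linarith
  have hmeas : Measurable fun ω => totalCuts a l (n + 1) ω :=
    Measurable.tsum fun m => Finset.measurable_sum _ fun i _ =>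
      measurable_cuts_randOffset l (n + 1 + m) (a i) i
  calc ∫⁻ ω, (∫⁻ x in Q, ∫⁻ y in Q, ‖F ω x - F ω y‖ₑ) ∂randMeasure N
      ≤ ∫⁻ ω, (2 * volume Q) * (2 ^ N * ((2 ^ N * volume Q) *
          (1 + 2 ^ N * totalCuts a l (n + 1) ω))) ∂randMeasure N := by
        refine lintegral_mono_ae (h.mono fun ω hω => ?_)
        obtain ⟨b, hb⟩ := lintegral_cube_enorm_sub_le hω a hl.le hn2
        rw [← hQ] at hb
        refine (lintegral_lintegral_enorm_sub_le (volume.restrict Q)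
          (hF.comp measurable_prodMk_left) b).trans ?_
        rw [Measure.restrict_apply_univ]
        change _ * ∫⁻ y in Q, ‖F ω y - b‖ₑ ≤ _
        gcongr
        refine hb.trans ?_
        gcongr
    _ = (2 * volume Q) * (2 ^ N * ((2 ^ N * volume Q) *
          (1 + 2 ^ N * ∫⁻ ω, totalCuts a l (n + 1) ω ∂randMeasure N))) := by
        have hm1 : Measurable fun ω => 1 + 2 ^ N * totalCuts a l (n + 1) ω :=
          (hmeas.const_mul _).const_add _
        rw [lintegral_const_mul _ ((hm1.const_mul _).const_mul _),
          lintegral_const_mul _ (hm1.const_mul _), lintegral_const_mul _ hm1,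
          lintegral_add_left measurable_const, lintegral_const_mul _ hmeas, lintegral_const,
          measure_univ, one_mul]
    _ ≤ (2 * volume Q) * (2 ^ N * ((2 ^ N * volume Q) * (1 + 2 ^ N * (2 * N)))) := by
        gcongr
        exact lintegral_totalCuts_le a hl.le hn2
    _ = _ := by
        have h1 : ENNReal.ofReal (2 * 4 ^ N * (1 + 2 ^ N * (2 * N))) =
            2 * 4 ^ N * (1 + 2 ^ N * (2 * N)) := by
          rw [show (2 * 4 ^ N * (1 + 2 ^ N * (2 * N)) : ℝ) =
            ((2 * 4 ^ N * (1 + 2 ^ N * (2 * N)) : ℕ) : ℝ) by push_cast; rfl,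
            ENNReal.ofReal_natCast]
          push_cast
          rfl
        rw [h1, show (4 : ℝ≥0∞) ^ N = 2 ^ N * 2 ^ N by rw [← mul_pow]; norm_num]
        ring

lemma lintegral_lintegral_enorm_sub_integral_le {Ω α : Type*} [MeasurableSpace Ω]
    [MeasurableSpace α] {μ : Measure Ω} {ν : Measure α} {F : Ω → α → ℝ}
    (hi : ∀ᵐ x ∂ν, Integrable (fun ω => F ω x) μ) :
    ∫⁻ x, ∫⁻ y, ‖(∫ ω, F ω x ∂μ) - ∫ ω, F ω y ∂μ‖ₑ ∂ν ∂ν ≤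
      ∫⁻ x, ∫⁻ y, ∫⁻ ω, ‖F ω x - F ω y‖ₑ ∂μ ∂ν ∂ν := by
  refine lintegral_mono_ae (hi.mono fun x hx => lintegral_mono_ae (hi.mono fun y hy => ?_))
  rw [← integral_sub hx hy]
  exact enorm_integral_le_lintegral_enorm _

section Averaging

variable {Ω α : Type*} [MeasurableSpace Ω] [MeasurableSpace α] {μ : Measure Ω} {ν : Measure α}
  [SFinite μ] [SFinite ν] {F : Ω → α → ℝ}

lemma lintegral_rotate (hF : Measurable (Function.uncurry F)) :
    ∫⁻ x, ∫⁻ y, ∫⁻ ω, ‖F ω x - F ω y‖ₑ ∂μ ∂ν ∂ν =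
      ∫⁻ ω, ∫⁻ x, ∫⁻ y, ‖F ω x - F ω y‖ₑ ∂ν ∂ν ∂μ := by
  have hx : ∀ x, Measurable fun p : α × Ω => ‖F p.2 x - F p.2 p.1‖ₑ := fun x =>
    ((hF.comp (measurable_snd.prodMk measurable_const)).sub
      (hF.comp (measurable_snd.prodMk measurable_fst))).enorm
  have h3 : Measurable fun p : (α × Ω) × α => ‖F p.1.2 p.1.1 - F p.1.2 p.2‖ₑ :=
    ((hF.comp (measurable_fst.snd.prodMk measurable_fst.fst)).sub
      (hF.comp (measurable_fst.snd.prodMk measurable_snd))).enorm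
  calc ∫⁻ x, ∫⁻ y, ∫⁻ ω, ‖F ω x - F ω y‖ₑ ∂μ ∂ν ∂ν
      = ∫⁻ x, ∫⁻ ω, ∫⁻ y, ‖F ω x - F ω y‖ₑ ∂ν ∂μ ∂ν :=
        lintegral_congr fun x => lintegral_lintegral_swap (hx x).aemeasurable
    _ = _ := lintegral_lintegral_swap h3.lintegral_prod_right'.aemeasurable

lemma integrable_integral_of_oscillation [IsFiniteMeasure ν]
    (hF : Measurable (Function.uncurry F)) (hi : ∀ᵐ x ∂ν, Integrable (fun ω => F ω x) μ)
    (h : ∫⁻ x, ∫⁻ y, ∫⁻ ω, ‖F ω x - F ω y‖ₑ ∂μ ∂ν ∂ν ≠ ⊤) :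
    Integrable (fun x => ∫ ω, F ω x ∂μ) ν := by
  have hsm : StronglyMeasurable fun x => ∫ ω, F ω x ∂μ :=
    (hF.comp measurable_swap).stronglyMeasurable.integral_prod_right'
  rcases eq_zero_or_neZero ν with rfl | hν
  · exact integrable_zero_measure
  have h3 : Measurable fun p : (α × α) × Ω => ‖F p.2 p.1.1 - F p.2 p.1.2‖ₑ :=
    ((hF.comp (measurable_snd.prodMk measurable_fst.fst)).sub
      (hF.comp (measurable_snd.prodMk measurable_fst.snd))).enorm
  obtain ⟨x, hx1, hx2⟩ := ((ae_lt_top h3.lintegral_prod_right'.lintegral_prod_right' h).and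
    hi).exists
  refine ⟨hsm.aestronglyMeasurable, ?_⟩
  refine lt_of_le_of_lt (b := ∫⁻ y, ((∫⁻ ω, ‖F ω x - F ω y‖ₑ ∂μ) + ‖∫ ω, F ω x ∂μ‖ₑ) ∂ν) ?_ ?_
  · refine lintegral_mono_ae (hi.mono fun y hy => ?_)
    have h1 : ∫ ω, F ω y ∂μ = (∫ ω, F ω x ∂μ) - ∫ ω, (F ω x - F ω y) ∂μ := by
      rw [integral_sub hx2 hy]; ring
    beta_reduce
    rw [h1, add_comm]
    refine enorm_sub_le.trans ?_
    gcongr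
    exact enorm_integral_le_lintegral_enorm _
  · rw [lintegral_add_right _ measurable_const, lintegral_const]
    exact ENNReal.add_lt_top.2 ⟨hx1, ENNReal.mul_lt_top enorm_lt_top (measure_lt_top _ _)⟩

end Averaging

/-- **BMO from dyadic BMO (one-parameter)**: if `ω ↦ f_ω` is a jointly measurable family
with `‖f_ω‖_{BMO_{𝒟(ω)}} ≤ 1` for a.e. `ω` (each `f_ω` being locally integrable), and the
expectation `f(x) = 𝔼_ω f_ω(x)` exists for a.e. `x`, then `f ∈ BMO(ℝ^N)` with
`‖f‖_{BMO} ≤ C(N)`. -/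
theorem bmo_from_dyadic_bmo (N : ℕ) (hN : 0 < N) :
    ∃ C : ℝ, 0 < C ∧
      ∀ F : RSpace N → (Fin N → ℝ) → ℝ,
        Measurable (Function.uncurry F) →
        (∀ᵐ ω ∂randMeasure N, ∀ (k : ℤ) (x : Fin N → ℝ),
          IntegrableOn (F ω) (dcube (randOffset ω k) k x) volume ∧
          cubeOsc (F ω) (dcube (randOffset ω k) k x) ≤ 1) →
        (∀ᵐ x : Fin N → ℝ, Integrable (fun ω => F ω x) (randMeasure N)) →
        ∀ Q : Set (Fin N → ℝ), IsPCube Q →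
          IntegrableOn (fun x => ∫ ω, F ω x ∂randMeasure N) Q volume ∧
          cubeOsc (fun x => ∫ ω, F ω x ∂randMeasure N) Q ≤ C := by
  refine ⟨2 * 4 ^ N * (1 + 2 ^ N * (2 * N)), by positivity, ?_⟩
  rintro F hF hbmo hint Q ⟨a, l, hl, hQ⟩
  have hvol : volume Q = ENNReal.ofReal (l ^ N) := by
    rw [hQ, Real.volume_pi_Ico, ENNReal.ofReal_pow hl.le]
    simp
  have : IsFiniteMeasure (volume.restrict Q) :=
    ⟨by rw [Measure.restrict_apply_univ, hvol]; exact ENNReal.ofReal_lt_top⟩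
  have hosc := lintegral_oscillation_le hF hbmo a hl hQ
  rw [← lintegral_rotate hF] at hosc
  have hiQ := ae_restrict_of_ae (s := Q) hint
  have hfQ : IntegrableOn (fun x => ∫ ω, F ω x ∂randMeasure N) Q volume :=
    integrable_integral_of_oscillation hF hiQ
      (ne_top_of_le_ne_top (ENNReal.mul_ne_top ENNReal.ofReal_ne_top
        (ENNReal.pow_ne_top (by rw [hvol]; exact ENNReal.ofReal_ne_top))) hosc)
  refine ⟨hfQ, cubeOsc_le_of_lintegral (by positivity) ?_ hfQ
    ((lintegral_lintegral_enorm_sub_integral_le hiQ).trans hosc)⟩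
  rw [hvol, ENNReal.toReal_ofReal (by positivity)]
  positivity

end Treil
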